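/- Robust interference-power constraint as an LMI: Let R be an n×n Hermitian complex matrix, f̄ ∈ ℂⁿ, ε > 0, and let c ∈ ℝ. Then the following are equivalent: (i) for every Δ ∈ ℂⁿ with ‖Δ‖² ≤ ε², the real number (f̄ + Δ)ᴴ R (f̄ + Δ) is at most c; (ii) there exists λ ≥ 0 such that the (n+1)×(n+1) block matrix [[λ I − R, −R f̄], [(−R f̄)ᴴ, c − f̄ᴴ R f̄ − λ ε²]] is positive semidefinite. -/

import Mathlib

open Matrix ComplexOrder

/-- The Hermitian block matrix `[[A, b], [bᴴ, c]]`. -/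
noncomputable def blockMat {n : ℕ} (A : Matrix (Fin n) (Fin n) ℂ) (b : Fin n → ℂ) (c : ℝ) :
    Matrix (Fin n ⊕ Fin 1) (Fin n ⊕ Fin 1) ℂ :=
  Matrix.fromBlocks A (Matrix.of fun i _ => b i) (Matrix.of fun _ j => star (b j))
    (Matrix.of fun _ _ => (c : ℂ))

/-- The real quadratic form attached to a complex matrix. -/
noncomputable def hermForm {m : Type*} [Fintype m] (A : Matrix m m ℂ) (x : m → ℂ) : ℝ :=
  (star x ⬝ᵥ A *ᵥ x).re

section HermForm

variable {m : Type*} [Fintype m] (A B : Matrix m m ℂ)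

lemma hermForm_smul (a : ℂ) (x : m → ℂ) : hermForm A (a • x) = ‖a‖ ^ 2 * hermForm A x := by
  have h : star (a • x) ⬝ᵥ A *ᵥ (a • x) = ((‖a‖ ^ 2 : ℝ) : ℂ) * (star x ⬝ᵥ A *ᵥ x) := by
    rw [star_smul, smul_dotProduct, mulVec_smul, dotProduct_smul, smul_smul, smul_eq_mul,
      Complex.star_def, Complex.conj_mul']
    push_cast
    rfl
  rw [hermForm, h, Complex.re_ofReal_mul, hermForm]

lemma hermForm_sub_smul (r : ℝ) (x : m → ℂ) :
    hermForm (A - (r : ℂ) • B) x = hermForm A x - r * hermForm B x := by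
  simp [hermForm, sub_mulVec, smul_mulVec, dotProduct_sub, dotProduct_smul]

variable {A B}

lemma Matrix.IsHermitian.hermForm_add (hA : A.IsHermitian) (x y : m → ℂ) :
    hermForm A (x + y) = hermForm A x + hermForm A y + 2 * (star x ⬝ᵥ A *ᵥ y).re := by
  have h : star y ⬝ᵥ A *ᵥ x = star (star x ⬝ᵥ A *ᵥ y) := by
    rw [star_dotProduct, star_mulVec, hA.eq, dotProduct_mulVec]
  have h' : (star y ⬝ᵥ A *ᵥ x).re = (star x ⬝ᵥ A *ᵥ y).re := by rw [h]; simp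
  simp only [hermForm, star_add, mulVec_add, dotProduct_add, add_dotProduct, Complex.add_re, h']
  ring

lemma hermForm_neg_vec (x : m → ℂ) : hermForm A (-x) = hermForm A x := by
  simp [hermForm, mulVec_neg]

lemma Matrix.IsHermitian.hermForm_sub (hA : A.IsHermitian) (x y : m → ℂ) :
    hermForm A (x - y) = hermForm A x + hermForm A y - 2 * (star x ⬝ᵥ A *ᵥ y).re := by
  rw [sub_eq_add_neg, hA.hermForm_add, hermForm_neg_vec]
  simp [mulVec_neg]
  ring

lemma Matrix.IsHermitian.posSemidef_of_hermForm_nonneg (hA : A.IsHermitian)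
    (h : ∀ x, 0 ≤ hermForm A x) : A.PosSemidef := by
  refine .of_dotProduct_mulVec_nonneg hA fun x ↦ Complex.nonneg_iff.2 ⟨h x, ?_⟩
  exact (hA.im_star_dotProduct_mulVec_self x).symm

lemma Matrix.PosSemidef.hermForm_nonneg (hA : A.PosSemidef) (x : m → ℂ) : 0 ≤ hermForm A x :=
  (Complex.nonneg_iff.1 (hA.dotProduct_mulVec_nonneg x)).1

lemma Complex.exists_norm_eq_one_re_mul_eq_zero (b : ℂ) : ∃ u : ℂ, ‖u‖ = 1 ∧ (u * b).re = 0 := by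
  rcases eq_or_ne b 0 with rfl | hb
  · exact ⟨1, by simp⟩
  · have hb' : (‖b‖ : ℂ) ≠ 0 := by simpa using hb
    refine ⟨Complex.I * (starRingEnd ℂ b / ‖b‖), by simp [hb], ?_⟩
    have : Complex.I * (starRingEnd ℂ b / ‖b‖) * b = (‖b‖ : ℝ) * Complex.I := by
      rw [mul_assoc, div_mul_eq_mul_div, Complex.conj_mul']
      field_simp
    rw [this]
    simp

/-- Two vectors at which `B` has opposite signs are combined, with a phase cancelling the cross
term, into vectors isotropic for `B`. -/
lemma hermForm_mul_le_of_pos_of_neg (hA : A.IsHermitian) (hB : B.IsHermitian)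
    (h : ∀ x, 0 ≤ hermForm B x → 0 ≤ hermForm A x) {x y : m → ℂ}
    (hx : 0 < hermForm B x) (hy : hermForm B y < 0) :
    hermForm A x * hermForm B y ≤ hermForm A y * hermForm B x := by
  obtain ⟨u, hu, hre⟩ := Complex.exists_norm_eq_one_re_mul_eq_zero (star x ⬝ᵥ B *ᵥ y)
  set s : ℝ := √(-hermForm B y) with hs
  set t : ℝ := √(hermForm B x) with ht
  have hs2 : s ^ 2 = -hermForm B y := Real.sq_sqrt (by linarith)
  have ht2 : t ^ 2 = hermForm B x := Real.sq_sqrt hx.le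
  have hsn : ‖(s : ℂ)‖ ^ 2 = -hermForm B y := by rw [Complex.norm_real, ← hs2]; simp
  have htn : ‖(t : ℂ) * u‖ ^ 2 = hermForm B x := by
    rw [norm_mul, hu, Complex.norm_real, mul_one, ← ht2]; simp
  have hcross : (star ((s : ℂ) • x) ⬝ᵥ B *ᵥ (((t : ℂ) * u) • y)).re = 0 := by
    have : star ((s : ℂ) • x) ⬝ᵥ B *ᵥ (((t : ℂ) * u) • y)
        = ((s * t : ℝ) : ℂ) * (u * (star x ⬝ᵥ B *ᵥ y)) := by
      rw [star_smul, smul_dotProduct, mulVec_smul, dotProduct_smul]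
      simp
      ring
    rw [this, Complex.re_ofReal_mul, hre, mul_zero]
  have hadd := h ((s : ℂ) • x + ((t : ℂ) * u) • y) <| by
    rw [hB.hermForm_add, hcross, hermForm_smul, hermForm_smul, hsn, htn]
    linarith
  have hsub := h ((s : ℂ) • x - ((t : ℂ) * u) • y) <| by
    rw [hB.hermForm_sub, hcross, hermForm_smul, hermForm_smul, hsn, htn]
    linarith
  rw [hA.hermForm_add, hermForm_smul, hermForm_smul, hsn, htn] at hadd
  rw [hA.hermForm_sub, hermForm_smul, hermForm_smul, hsn, htn] at hsub
  linarith

/-- The **S-lemma** for Hermitian forms. -/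
theorem exists_posSemidef_sub_smul_of_hermForm_nonneg (hA : A.IsHermitian) (hB : B.IsHermitian)
    {x₀ : m → ℂ} (hx₀ : 0 < hermForm B x₀) (h : ∀ x, 0 ≤ hermForm B x → 0 ≤ hermForm A x) :
    ∃ r : ℝ, 0 ≤ r ∧ (A - (r : ℂ) • B).PosSemidef := by
  set S : Set ℝ := {r | ∃ x, 0 < hermForm B x ∧ hermForm A x / hermForm B x = r}
  have hne : S.Nonempty := ⟨_, x₀, hx₀, rfl⟩
  have hS : ∀ r ∈ S, 0 ≤ r := by
    rintro _ ⟨x, hx, rfl⟩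
    exact div_nonneg (h x hx.le) hx.le
  have hherm : (A - ((sInf S : ℝ) : ℂ) • B).IsHermitian := by
    refine hA.sub ?_
    rw [IsHermitian, conjTranspose_smul, hB.eq, Complex.star_def, Complex.conj_ofReal]
  refine ⟨sInf S, le_csInf hne hS, hherm.posSemidef_of_hermForm_nonneg fun x ↦ ?_⟩
  rw [hermForm_sub_smul, sub_nonneg]
  rcases lt_trichotomy (hermForm B x) 0 with hx | hx | hx
  · rw [← div_le_iff_of_neg hx]
    refine le_csInf hne ?_
    rintro _ ⟨y, hy, rfl⟩
    rw [div_le_iff_of_neg hx, div_mul_eq_mul_div, div_le_iff₀ hy]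
    exact hermForm_mul_le_of_pos_of_neg hA hB h hy hx
  · rw [hx, mul_zero]
    exact h x hx.ge
  · rw [← le_div_iff₀ hx]
    exact csInf_le ⟨0, hS⟩ ⟨x, hx, rfl⟩

lemma hermForm_neg (x : m → ℂ) : hermForm (-A) x = -hermForm A x := by
  simp [hermForm, neg_mulVec]

lemma hermForm_one [DecidableEq m] (x : m → ℂ) :
    hermForm (1 : Matrix m m ℂ) x = ∑ i, ‖x i‖ ^ 2 := by
  simp [hermForm, dotProduct, Complex.conj_mul', ← Complex.ofReal_pow]

end HermForm

section BlockMat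

variable {n : ℕ}

lemma isHermitian_blockMat {A : Matrix (Fin n) (Fin n) ℂ} (hA : A.IsHermitian) (b : Fin n → ℂ)
    (c : ℝ) : (blockMat A b c).IsHermitian := by
  refine IsHermitian.fromBlocks hA ?_ ?_
  · ext i j
    simp
  · ext i j
    simp

lemma hermForm_blockMat (A : Matrix (Fin n) (Fin n) ℂ) (b : Fin n → ℂ) (c : ℝ) (y : Fin n → ℂ)
    (t : ℂ) : hermForm (blockMat A b c) (Sum.elim y fun _ ↦ t)
      = hermForm A y + 2 * (t * (star y ⬝ᵥ b)).re + c * ‖t‖ ^ 2 := by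
  have h₁ : (of fun i (_ : Fin 1) ↦ b i) *ᵥ (fun _ ↦ t) = t • b := by
    ext i
    simp [mulVec, dotProduct, mul_comm]
  have h₂ : star t * (star b ⬝ᵥ y) = star (t * (star y ⬝ᵥ b)) := by
    rw [star_dotProduct b, star_mul']
  have h₃ : (star t * (star b ⬝ᵥ y)).re = (t * (star y ⬝ᵥ b)).re := by rw [h₂]; simp
  have h₄ : (star t * ((c : ℂ) * t)).re = c * ‖t‖ ^ 2 := by
    rw [mul_left_comm, Complex.star_def, Complex.conj_mul', Complex.re_ofReal_mul,
      ← Complex.ofReal_pow, Complex.ofReal_re]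
  have h : star (Sum.elim y fun _ : Fin 1 ↦ t) ⬝ᵥ blockMat A b c *ᵥ (Sum.elim y fun _ ↦ t)
      = star y ⬝ᵥ A *ᵥ y + t * (star y ⬝ᵥ b)
        + (star t * (star b ⬝ᵥ y) + star t * ((c : ℂ) * t)) := by
    rw [blockMat, fromBlocks_mulVec, Sum.elim_comp_inl, Sum.elim_comp_inr, h₁]
    simp [dotProduct, mulVec, Fintype.sum_sum_type, mul_add, Finset.sum_add_distrib,
      Finset.mul_sum, mul_left_comm]
  rw [hermForm, h, Complex.add_re, Complex.add_re, Complex.add_re, h₃, h₄, hermForm]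
  ring

lemma blockMat_sub_smul (A B : Matrix (Fin n) (Fin n) ℂ) (a b : Fin n → ℂ) (c d r : ℝ) :
    blockMat A a c - (r : ℂ) • blockMat B b d
      = blockMat (A - (r : ℂ) • B) (a - (r : ℂ) • b) (c - r * d) := by
  ext (i | i) (j | j) <;> simp [blockMat]

lemma hermForm_blockMat_neg {R : Matrix (Fin n) (Fin n) ℂ} (hR : R.IsHermitian) (f : Fin n → ℂ)
    (c : ℝ) (y : Fin n → ℂ) (t : ℂ) :
    hermForm (blockMat (-R) (-(R *ᵥ f)) (c - hermForm R f)) (Sum.elim y fun _ ↦ t)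
      = c * ‖t‖ ^ 2 - hermForm R (y + t • f) := by
  rw [hermForm_blockMat, hermForm_neg, hR.hermForm_add, hermForm_smul, mulVec_smul,
    dotProduct_smul, dotProduct_neg, smul_eq_mul, mul_neg, Complex.neg_re]
  ring

lemma hermForm_blockMat_neg_one (d : ℝ) (y : Fin n → ℂ) (t : ℂ) :
    hermForm (blockMat (-1 : Matrix (Fin n) (Fin n) ℂ) 0 d) (Sum.elim y fun _ ↦ t)
      = d * ‖t‖ ^ 2 - ∑ i, ‖y i‖ ^ 2 := by
  rw [hermForm_blockMat, hermForm_neg, hermForm_one]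
  simp
  ring

end BlockMat

/-- Robust interference-power constraint as an LMI. -/
theorem robust_interference_lmi {n : ℕ} (R : Matrix (Fin n) (Fin n) ℂ) (hR : R.IsHermitian)
    (fbar : Fin n → ℂ) (ε : ℝ) (hε : 0 < ε) (c : ℝ) :
    (∀ Δ : Fin n → ℂ, (∑ i, ‖Δ i‖ ^ 2) ≤ ε ^ 2 →
        (star (fbar + Δ) ⬝ᵥ R *ᵥ (fbar + Δ)).re ≤ c) ↔
      ∃ lam : ℝ, 0 ≤ lam ∧
        (blockMat ((lam : ℂ) • (1 : Matrix (Fin n) (Fin n) ℂ) - R) (-(R *ᵥ fbar))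
          (c - (star fbar ⬝ᵥ R *ᵥ fbar).re - lam * ε ^ 2)).PosSemidef := by
  change (∀ Δ : Fin n → ℂ, (∑ i, ‖Δ i‖ ^ 2) ≤ ε ^ 2 → hermForm R (fbar + Δ) ≤ c) ↔ _
  set P := blockMat (-R) (-(R *ᵥ fbar)) (c - hermForm R fbar) with hP
  set Q := blockMat (-1 : Matrix (Fin n) (Fin n) ℂ) 0 (ε ^ 2) with hQ
  have hPQ (r : ℝ) : blockMat ((r : ℂ) • (1 : Matrix (Fin n) (Fin n) ℂ) - R) (-(R *ᵥ fbar))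
      (c - (star fbar ⬝ᵥ R *ᵥ fbar).re - r * ε ^ 2) = P - (r : ℂ) • Q := by
    rw [hP, hQ, blockMat_sub_smul, smul_zero, sub_zero, smul_neg, sub_neg_eq_add, neg_add_eq_sub,
      hermForm]
  simp only [hPQ]
  constructor
  · intro h
    refine exists_posSemidef_sub_smul_of_hermForm_nonneg (isHermitian_blockMat hR.neg _ _)
      (isHermitian_blockMat isHermitian_one.neg _ _) (x₀ := Sum.elim 0 fun _ ↦ 1) ?_ fun x hx ↦ ?_
    · rw [hermForm_blockMat_neg_one]
      simpa using pow_pos hε 2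
    · obtain ⟨y, t, rfl⟩ : ∃ y t, x = Sum.elim y fun _ ↦ t :=
        ⟨x ∘ Sum.inl, x (Sum.inr 0), by
          ext (i | i)
          · rfl
          · rw [Subsingleton.elim i 0, Sum.elim_inr]⟩
      rw [hermForm_blockMat_neg_one, sub_nonneg] at hx
      rw [hermForm_blockMat_neg hR, sub_nonneg]
      rcases eq_or_ne t 0 with rfl | ht
      · have hy : y = 0 := by
          have h0 : ∑ i, ‖y i‖ ^ 2 = 0 :=
            le_antisymm (by simpa using hx) (Finset.sum_nonneg fun i _ ↦ by positivity)
          ext i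
          simpa using (Finset.sum_eq_zero_iff_of_nonneg fun i _ ↦ by positivity).1 h0 i
        simp [hy, hermForm]
      · have ht' : 0 < ‖t‖ ^ 2 := by positivity
        have hy : y + t • fbar = t • (fbar + t⁻¹ • y) := by
          rw [smul_add, smul_inv_smul₀ ht, add_comm]
        rw [hy, hermForm_smul, mul_comm]
        refine mul_le_mul_of_nonneg_right (h _ ?_) ht'.le
        simp only [Pi.smul_apply, norm_smul, mul_pow, ← Finset.mul_sum, norm_inv, inv_pow]
        rwa [inv_mul_le_iff₀ ht', mul_comm]
  · rintro ⟨r, hr, hpsd⟩ Δ hΔ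
    have := hpsd.hermForm_nonneg (Sum.elim Δ fun _ ↦ 1)
    rw [hermForm_sub_smul, hermForm_blockMat_neg hR, hermForm_blockMat_neg_one, one_smul,
      add_comm Δ] at this
    simp only [norm_one, one_pow, mul_one] at this
    nlinarith [mul_nonneg hr (sub_nonneg.2 hΔ)]
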